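/- Let E be a real normed vector space, let f : E → E be Lipschitz with constant k where 0 ≤ k < 1, and let β satisfy 0 < β < 2/(k+1). Define φ : E × E → E × E by φ(y, z) = ((1−β)·y + β·f(z), (1−β)·z + β·f((1−β)·y + β·f(z))), and equip E × E with the max norm ‖(y, z)‖∞ = max(‖y‖, ‖z‖). Then φ is Lipschitz with constant L = |1−β| + β·k, and L < 1; in particular φ is a contraction in the max norm. -/

import Mathlib

/-- A relaxed step `(1 - β) • a + β • f c` moves by at most `(|1 - β| + β * k) * M` when both
arguments move by at most `M` and `f` is `k`-Lipschitz. -/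
theorem norm_relaxed_step_sub_le {E : Type*} [NormedAddCommGroup E] [NormedSpace ℝ E]
    {f : E → E} {k : ℝ} (hk0 : 0 ≤ k) (hf : ∀ a b : E, ‖f a - f b‖ ≤ k * ‖a - b‖)
    {β : ℝ} (hβ0 : 0 ≤ β) {M : ℝ} {a b c d : E} (hab : ‖a - b‖ ≤ M) (hcd : ‖c - d‖ ≤ M) :
    ‖((1 - β) • a + β • f c) - ((1 - β) • b + β • f d)‖ ≤ (|1 - β| + β * k) * M :=
  calc ‖((1 - β) • a + β • f c) - ((1 - β) • b + β • f d)‖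
      = ‖(1 - β) • (a - b) + β • (f c - f d)‖ := by
        congr 1
        module
    _ ≤ |1 - β| * ‖a - b‖ + β * ‖f c - f d‖ := by
        refine (norm_add_le _ _).trans_eq ?_
        rw [norm_smul, norm_smul, Real.norm_eq_abs, Real.norm_of_nonneg hβ0]
    _ ≤ |1 - β| * M + β * (k * M) := by
        gcongr
        exact (hf c d).trans (by gcongr)
    _ = (|1 - β| + β * k) * M := by ring

/-- The reversible iteration map `φ` is Lipschitz with constant `L = |1−β| + β·k`
with respect to the max norm on `E × E`, and `L < 1`, i.e. `φ` is a contraction. -/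
theorem reversible_map_contraction {E : Type*} [NormedAddCommGroup E]
    [NormedSpace ℝ E]
    (f : E → E) (k : ℝ) (hk0 : 0 ≤ k) (hk1 : k < 1)
    (hf : ∀ a b : E, ‖f a - f b‖ ≤ k * ‖a - b‖)
    (β : ℝ) (hβ0 : 0 < β) (hβ2 : β < 2 / (k + 1))
    (φ : E × E → E × E)
    (hφ : ∀ p : E × E,
      φ p = ((1 - β) • p.1 + β • f p.2,
             (1 - β) • p.2 + β • f ((1 - β) • p.1 + β • f p.2)))
    (L : ℝ) (hL : L = |1 - β| + β * k) :
    (∀ p p' : E × E,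
        max ‖(φ p).1 - (φ p').1‖ ‖(φ p).2 - (φ p').2‖ ≤
          L * max ‖p.1 - p'.1‖ ‖p.2 - p'.2‖) ∧ L < 1 := by
  have hL1 : L < 1 := by
    rw [lt_div_iff₀ (by linarith)] at hβ2
    rcases abs_cases (1 - β) with ⟨h, _⟩ | ⟨h, _⟩ <;> rw [hL, h] <;> nlinarith
  refine ⟨fun p p' => ?_, hL1⟩
  set M := max ‖p.1 - p'.1‖ ‖p.2 - p'.2‖
  have h₁ : ‖p.1 - p'.1‖ ≤ M := le_max_left _ _
  have h₂ : ‖p.2 - p'.2‖ ≤ M := le_max_right _ _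
  have hM : 0 ≤ M := (norm_nonneg _).trans h₁
  have hy := norm_relaxed_step_sub_le hk0 hf hβ0.le h₁ h₂
  rw [← hL] at hy
  have hz := norm_relaxed_step_sub_le hk0 hf hβ0.le h₂
    (hy.trans (mul_le_of_le_one_left hM hL1.le))
  rw [← hL] at hz
  rw [hφ p, hφ p']
  exact max_le hy hz
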